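/- arXiv:2109.01430 — 3 statements merged into one kernel-verified Lean document; each statement's English description precedes it below -/
import Mathlib

section
/- The lexicographic braiding satisfies the permutative hexagon identity: for all natural numbers m, n, p, one has ξ_{m,n·p} = (id_{⟨n⟩} ∧ ξ_{m,p}) ∘ (ξ_{m,n} ∧ id_{⟨p⟩}) as basepoint-preserving maps ⟨m·n·p⟩ → ⟨n·p·m⟩. -/
/-- The pointed finite set `⟨n⟩ = {0,1,…,n}` with basepoint `0`, realized as `Fin (n+1)`. -/
abbrev Pt (n : ℕ) : Type := Fin (n + 1)

/-- The lexicographic pairing `L_{m,n} : ⟨m⟩ × ⟨n⟩ → ⟨m·n⟩`, given by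
`L(x,y) = 0` if `x = 0` or `y = 0`, and `L(x,y) = n·(x−1)+y` otherwise. -/
def lexL (m n : ℕ) (x : Pt m) (y : Pt n) : Pt (m * n) :=
  if h : x.val = 0 ∨ y.val = 0 then 0
  else ⟨n * (x.val - 1) + y.val, by
    push_neg at h
    obtain ⟨hx, hy⟩ := h
    have hxm : x.val ≤ m := Nat.lt_succ_iff.mp x.isLt
    have hyn : y.val ≤ n := Nat.lt_succ_iff.mp y.isLt
    have h1 : n * (x.val - 1) ≤ n * (m - 1) :=
      Nat.mul_le_mul_left _ (by omega)
    have h2 : n * (m - 1) + n = n * m := by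
      rw [← Nat.mul_succ]
      congr 1
      omega
    have h3 : n * m = m * n := Nat.mul_comm n m
    omega⟩


/-- First coordinate of the inverse of the lexicographic pairing. -/
def unL1 (m n : ℕ) (z : Pt (m * n)) : Pt m :=
  if hz : z.val = 0 then 0
  else ⟨(z.val - 1) / n + 1, by
    have hzl : z.val ≤ m * n := Nat.lt_succ_iff.mp z.isLt
    have hn : 0 < n := by
      rcases Nat.eq_zero_or_pos n with h | h
      · exfalso
        have h0 : m * n = 0 := by rw [h, Nat.mul_zero]
        omega
      · exact h
    have : (z.val - 1) / n < m := by
      rw [Nat.div_lt_iff_lt_mul hn]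
      omega
    omega⟩

/-- Second coordinate of the inverse of the lexicographic pairing. -/
def unL2 (m n : ℕ) (z : Pt (m * n)) : Pt n :=
  if hz : z.val = 0 then 0
  else ⟨(z.val - 1) % n + 1, by
    have hzl : z.val ≤ m * n := Nat.lt_succ_iff.mp z.isLt
    have hn : 0 < n := by
      rcases Nat.eq_zero_or_pos n with h | h
      · exfalso
        have h0 : m * n = 0 := by rw [h, Nat.mul_zero]
        omega
      · exact h
    have := Nat.mod_lt (z.val - 1) hn
    omega⟩

/-- The smash product `f ∧ g` of maps in lexicographic coordinates. -/
def smashMap {m n m' n' : ℕ} (f : Pt m → Pt m') (g : Pt n → Pt n') :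
    Pt (m * n) → Pt (m' * n') :=
  fun z => lexL m' n' (f (unL1 m n z)) (g (unL2 m n z))

/-- The lexicographic braiding `ξ_{m,n} : ⟨m·n⟩ → ⟨n·m⟩`. -/
def xiMap (m n : ℕ) : Pt (m * n) → Pt (n * m) :=
  fun z => lexL n m (unL2 m n z) (unL1 m n z)

theorem lexL_val (m n : ℕ) (x : Pt m) (y : Pt n) :
    (lexL m n x y).val = if x.val = 0 ∨ y.val = 0 then 0 else n * (x.val - 1) + y.val := by
  unfold lexL
  split_ifs <;> rfl

theorem unL1_val (m n : ℕ) (z : Pt (m * n)) :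
    (unL1 m n z).val = if z.val = 0 then 0 else (z.val - 1) / n + 1 := by
  unfold unL1
  split_ifs <;> rfl

theorem unL2_val (m n : ℕ) (z : Pt (m * n)) :
    (unL2 m n z).val = if z.val = 0 then 0 else (z.val - 1) % n + 1 := by
  unfold unL2
  split_ifs <;> rfl

theorem div_aux (k q r : ℕ) (h : r < k) : (k * q + r) / k = q := by
  rw [Nat.mul_add_div (by omega), Nat.div_eq_of_lt h, Nat.add_zero]

theorem mod_aux (k q r : ℕ) (h : r < k) : (k * q + r) % k = r := by
  rw [Nat.mul_add_mod, Nat.mod_eq_of_lt h]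

theorem hex_nat (m n p a b c : ℕ) (ha : a < m) (hb : b < n) (hc : c < p) :
    m * ((p * (n * a + b) + c) % (n * p)) + (p * (n * a + b) + c) / (n * p) =
    p * m * ((p * (m * b + a) + c) / (m * p)) +
      (m * ((p * (m * b + a) + c) % (m * p) % p) + (p * (m * b + a) + c) % (m * p) / p) := by
  have key : ∀ k b, b < k → p * b + c < k * p := by
    intro k b h
    nlinarith
  have e1 : p * (n * a + b) + c = n * p * a + (p * b + c) := by ring
  have e2 : p * (m * b + a) + c = m * p * b + (p * a + c) := by ring
  rw [e1, e2, div_aux _ _ _ (key n b hb), mod_aux _ _ _ (key n b hb),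
    div_aux _ _ _ (key m a ha), mod_aux _ _ _ (key m a ha), div_aux _ _ _ hc, mod_aux _ _ _ hc]
  ring

/-- the hexagon identity for the lexicographic braiding:
`ξ_{m,n·p} = (id_{⟨n⟩} ∧ ξ_{m,p}) ∘ (ξ_{m,n} ∧ id_{⟨p⟩})` as basepoint-preserving
maps `⟨m·n·p⟩ → ⟨n·p·m⟩` (the identifications of `⟨(m·n)·p⟩` with `⟨m·(n·p)⟩`, etc.,
being the evident relabelings `Fin.cast`). -/
theorem statement5 (m n p : ℕ) (z : Pt (m * n * p)) :
    (xiMap m (n * p) (Fin.cast (by ring) z)).val =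
      (smashMap (id : Pt n → Pt n) (xiMap m p)
        (Fin.cast (by ring) (smashMap (xiMap m n) (id : Pt p → Pt p) z))).val := by
  obtain ⟨w, hw⟩ := z
  rcases w with _ | w
  · simp [xiMap, smashMap, lexL_val, unL1_val, unL2_val]
  · have hw' : w < m * n * p := by omega
    have hp : 0 < p := Nat.pos_of_ne_zero (by rintro rfl; simp at hw')
    have hn : 0 < n := Nat.pos_of_ne_zero (by rintro rfl; simp at hw')
    have h1 : w / p < m * n := by rw [Nat.div_lt_iff_lt_mul hp]; exact hw'
    have h2 : w / p / n < m := by rw [Nat.div_lt_iff_lt_mul hn]; exact h1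
    have key := hex_nat m n p (w / p / n) (w / p % n) (w % p) h2
      (Nat.mod_lt _ hn) (Nat.mod_lt _ hp)
    rw [Nat.div_add_mod, Nat.div_add_mod] at key
    simp [xiMap, smashMap, lexL_val, unL1_val, unL2_val, ← add_assoc] at key ⊢
    exact key
end

section
/- Block components of a product of 𝒜-morphisms are smash products of the components: let φ^i : m^i → n^i (i = 1,…,k) be morphisms of 𝒜 and let φ be the induced product morphism on disjoint unions of products of blocks (with each product ∏_{i=1}^k {1,…,m^i_{j_i}} identified with {1,…,∏_i m^i_{j_i}} via iterated lexicographic pairing, and similarly for the targets). Then for all multi-indices (j₁,…,j_k) and (ℓ₁,…,ℓ_k) with ∅ ≠ (φ^i)⁻¹({1,…,n^i_{ℓ_i}}) ⊆ {1,…,m^i_{j_i}} for every i, the block component φ_{(j),(ℓ)} : ⟨∏_i m^i_{j_i}⟩ → ⟨∏_i n^i_{ℓ_i}⟩ equals the iterated smash product φ¹_{j₁,ℓ₁} ∧ ⋯ ∧ φ^k_{j_k,ℓ_k} of the component maps. -/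
/-- Objects of the category `𝒜`: finite sequences of positive integers. -/
abbrev AObj : Type := List ℕ+

/-- The size of the `i`-th block of `m`. -/
def blkLen (m : AObj) (i : Fin m.length) : ℕ := (m.get i : ℕ)

/-- The disjoint union `⨿_{i=1}^p {1,…,m_i}`, realized as a sigma type
(the `i`-th summand `{1,…,m_i}` being realized as `Fin m_i`). -/
def ASig (m : AObj) : Type := (i : Fin m.length) × Fin (blkLen m i)

/-- The block condition on a function between disjoint unions of blocks:
the preimage of each summand is either empty or contained in a single summand. -/
def Blk {m n : AObj} (φ : ASig m → ASig n) : Prop :=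
  ∀ a a' : ASig m, (φ a).1 = (φ a').1 → a.1 = a'.1

/-- The block component `φ_{i,j} : ⟨m_i⟩ → ⟨n_j⟩` of a block function `φ`:
it is `φ` on `φ⁻¹({1,…,n_j})` and `0` elsewhere. -/
def compIJ {m n : AObj} (φ : ASig m → ASig n) (i : Fin m.length) (j : Fin n.length) :
    Pt (blkLen m i) → Pt (blkLen n j) := fun x =>
  if hx : x.val = 0 then 0
  else
    let a : ASig m := ⟨i, ⟨x.val - 1, by have := x.isLt; omega⟩⟩
    if hj : (φ a).1 = j then
      ⟨(φ a).2.val + 1, by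
        have h2 : (φ a).2.val < blkLen n j := by rw [← hj]; exact (φ a).2.isLt
        omega⟩
    else 0

open Finset in
/-- The iterated lexicographic pairing
`⟨M₁⟩ × ⋯ × ⟨M_k⟩ → ⟨M₁⋯M_k⟩` (left-normalized). -/
def lexLk : (k : ℕ) → (M : Fin k → ℕ) → ((∀ i, Pt (M i)) → Pt (∏ i, M i))
  | 0, _ => fun _ => Fin.cast (by simp) (1 : Pt 1)
  | k + 1, M => fun x =>
      Fin.cast (by rw [Fin.prod_univ_castSucc])
        (lexL (∏ i : Fin k, M i.castSucc) (M (Fin.last k))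
          (lexLk k (fun i => M i.castSucc) (fun i => x i.castSucc)) (x (Fin.last k)))

/-- The inverse of the iterated lexicographic pairing. -/
def unLk : (k : ℕ) → (M : Fin k → ℕ) → (Pt (∏ i, M i) → ∀ i, Pt (M i))
  | 0, _ => fun _ i => i.elim0
  | k + 1, M => fun z =>
      let z' : Pt ((∏ i : Fin k, M i.castSucc) * M (Fin.last k)) :=
        Fin.cast (by rw [Fin.prod_univ_castSucc]) z
      Fin.lastCases (unL2 _ _ z')
        (fun i => unLk k (fun i => M i.castSucc) (unL1 _ _ z') i)

/-- The iterated smash product `f₁ ∧ ⋯ ∧ f_k` of basepoint-preserving maps, in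
lexicographic coordinates (left-normalized). -/
def smashMapk : (k : ℕ) → (M N : Fin k → ℕ) → (∀ i, Pt (M i) → Pt (N i)) →
    (Pt (∏ i, M i) → Pt (∏ i, N i))
  | 0, _, _ => fun _ z => Fin.cast (by simp) z
  | k + 1, M, N => fun f z =>
      Fin.cast (by rw [Fin.prod_univ_castSucc])
        (smashMap (smashMapk k (fun i => M i.castSucc) (fun i => N i.castSucc)
            (fun i => f i.castSucc)) (f (Fin.last k))
          (Fin.cast (by rw [Fin.prod_univ_castSucc]) z))

/-- The disjoint union, over multi-indices `(j₁,…,j_k)`, of the products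
`∏_{i=1}^k {1,…,m^i_{j_i}}`. -/
def PSig {k : ℕ} (m : Fin k → AObj) : Type :=
  (J : ∀ i, Fin (m i).length) × (∀ i, Fin (blkLen (m i) (J i)))

/-- The product of the block functions `φ^i`. -/
def prodFun {k : ℕ} {m n : Fin k → AObj} (φ : ∀ i, ASig (m i) → ASig (n i)) :
    PSig m → PSig n := fun A =>
  ⟨fun i => (φ i ⟨A.1 i, A.2 i⟩).1, fun i => (φ i ⟨A.1 i, A.2 i⟩).2⟩

/-- The block component, at multi-indices `(j₁,…,j_k)` and `(ℓ₁,…,ℓ_k)`, of the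
product of the block functions `φ^i`, in lexicographic coordinates: each product
block `∏_{i=1}^k {1,…,m^i_{j_i}}` is identified with `{1,…,∏_i m^i_{j_i}}` via
the iterated lexicographic pairing. -/
def prodCompLex {k : ℕ} {m n : Fin k → AObj} (φ : ∀ i, ASig (m i) → ASig (n i))
    (J : ∀ i, Fin (m i).length) (L : ∀ i, Fin (n i).length) :
    Pt (∏ i, blkLen (m i) (J i)) → Pt (∏ i, blkLen (n i) (L i)) := fun z =>
  if hz : z.val = 0 then 0
  else
    let a : ∀ i, Pt (blkLen (m i) (J i)) := unLk k _ z
    let A : PSig m := ⟨J, fun i => ⟨(a i).val - 1, by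
      have h1 := (a i).isLt
      have h2 : 0 < blkLen (m i) (J i) := ((m i).get (J i)).2
      omega⟩⟩
    if hL : (prodFun φ A).1 = L then
      lexLk k _ (fun i => ⟨((prodFun φ A).2 i).val + 1, by
        have h1 : ((prodFun φ A).2 i).val < blkLen (n i) (L i) := by
          rw [← congrFun hL i]
          exact ((prodFun φ A).2 i).isLt
        omega⟩)
    else 0

theorem unL1_zero {m n : ℕ} (z : Pt (m * n)) (hz : z.val = 0) : unL1 m n z = 0 := by
  simp only [unL1, dif_pos hz]

theorem unL1_ne {m n : ℕ} (z : Pt (m * n)) (hz : z.val ≠ 0) : (unL1 m n z).val ≠ 0 := by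
  rw [unL1, dif_neg hz]
  exact Nat.succ_ne_zero _

theorem unL2_ne {m n : ℕ} (z : Pt (m * n)) (hz : z.val ≠ 0) : (unL2 m n z).val ≠ 0 := by
  rw [unL2, dif_neg hz]
  exact Nat.succ_ne_zero _

theorem lexL_zero {m n : ℕ} (x : Pt m) (y : Pt n) (h : x.val = 0 ∨ y.val = 0) :
    (lexL m n x y).val = 0 := by
  simp only [lexL, dif_pos h]
  rfl

theorem unLk_ne : ∀ (k : ℕ) (M : Fin k → ℕ) (z : Pt (∏ i, M i)), z.val ≠ 0 →
    ∀ i, (unLk k M z i).val ≠ 0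
  | 0, _, _, _, i => i.elim0
  | k + 1, M, z, hz, i => by
    refine Fin.lastCases ?_ (fun i => ?_) i
    · simp only [unLk, Fin.lastCases_last]
      exact unL2_ne _ hz
    · simp only [unLk, Fin.lastCases_castSucc]
      exact unLk_ne k _ _ (unL1_ne _ hz) i

theorem lexLk_zero : ∀ (k : ℕ) (M : Fin k → ℕ) (x : ∀ i, Pt (M i)) (i : Fin k),
    (x i).val = 0 → (lexLk k M x).val = 0
  | 0, _, _, i => i.elim0
  | k + 1, M, x, i => by
    refine Fin.lastCases (fun h => ?_) (fun i h => ?_) i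
    · simp only [lexLk, Fin.val_cast]
      exact lexL_zero _ _ (Or.inr h)
    · simp only [lexLk, Fin.val_cast]
      exact lexL_zero _ _ (Or.inl (lexLk_zero k _ _ i h))

theorem smashMapk_zero : ∀ (k : ℕ) (M N : Fin k → ℕ) (f : ∀ i, Pt (M i) → Pt (N i))
    (z : Pt (∏ i, M i)), z.val = 0 → (smashMapk k M N f z).val = 0
  | 0, _, _, _, z, hz => by simpa only [smashMapk, Fin.val_cast] using hz
  | k + 1, M, N, f, z, hz => by
    simp only [smashMapk, Fin.val_cast, smashMap]
    refine lexL_zero _ _ (Or.inl (smashMapk_zero k _ _ _ _ ?_))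
    rw [unL1_zero _ hz]
    rfl

theorem smashMapk_ne : ∀ (k : ℕ) (M N : Fin k → ℕ) (f : ∀ i, Pt (M i) → Pt (N i))
    (z : Pt (∏ i, M i)), z.val ≠ 0 →
    smashMapk k M N f z = lexLk k N (fun i => f i (unLk k M z i))
  | 0, M, _, _, z, hz => by
    apply Fin.ext
    have h := z.isLt
    have h1 : ∏ i, M i = 1 := by simp
    simp only [smashMapk, lexLk, Fin.val_cast]
    have : ((1 : Pt 1) : ℕ) = 1 := rfl
    omega
  | k + 1, M, N, f, z, hz => by
    simp only [smashMapk, lexLk, smashMap, unLk, Fin.lastCases_last, Fin.lastCases_castSucc]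
    rw [smashMapk_ne k _ _ _ _ (unL1_ne _ hz)]

/-- STATEMENT 14: block components of a product of `𝒜`-morphisms are iterated
smash products of the block components: if, for every `i`,
`∅ ≠ (φ^i)⁻¹({1,…,n^i_{ℓ_i}}) ⊆ {1,…,m^i_{j_i}}`, then the block component
`φ_{(j),(ℓ)}` of the product equals `φ¹_{j₁,ℓ₁} ∧ ⋯ ∧ φ^k_{j_k,ℓ_k}`. -/
theorem statement14 {k : ℕ} (m n : Fin k → AObj)
    (φ : ∀ i, ASig (m i) → ASig (n i)) (hφ : ∀ i, Blk (φ i))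
    (J : ∀ i, Fin (m i).length) (L : ∀ i, Fin (n i).length)
    (hJL : ∀ i, (∃ a : ASig (m i), (φ i a).1 = L i) ∧
      (∀ a : ASig (m i), (φ i a).1 = L i → a.1 = J i)) :
    prodCompLex φ J L =
      smashMapk k (fun i => blkLen (m i) (J i)) (fun i => blkLen (n i) (L i))
        (fun i => compIJ (φ i) (J i) (L i)) := by
  funext z
  by_cases hz : z.val = 0
  · apply Fin.ext
    rw [smashMapk_zero k _ _ _ z hz]
    simp only [prodCompLex, dif_pos hz]
    rfl
  · rw [smashMapk_ne k _ _ _ z hz]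
    have hne := unLk_ne k _ z hz
    simp only [prodCompLex, dif_neg hz]
    split_ifs with hL
    · congr 1
      funext i
      have hi := congrFun hL i
      simp only [prodFun] at hi
      simp only [compIJ, dif_neg (hne i), dif_pos hi]
      rfl
    · obtain ⟨i, hi⟩ := Function.ne_iff.mp hL
      simp only [prodFun] at hi
      apply Fin.ext
      symm
      refine lexLk_zero k _ _ i ?_
      simp only [compIJ, dif_neg (hne i), dif_neg hi]
      rfl
end

section
/- Let (C, ⊗, 𝟙, Hom) be a complete and cocomplete symmetric monoidal closed category with terminal object T. For pointed objects X and Y of C, define the smash product X ∧ Y as the pushout in C of T ← (X ⊗ T) ⊔ (T ⊗ Y) → X ⊗ Y, where the right-hand map is (1_X ⊗ ι_Y) ⊔ (ι_X ⊗ 1_Y); define the smash unit E = 𝟙 ⊔ T; and define the pointed hom Hom_*(X,Y) as the pullback in C of Hom(X,Y) → Hom(T,Y) ← T, where the left map is restriction along ι_X and the right map is induced by ι_Y. Then the category of pointed objects T/C, equipped with (∧, E, Hom_*), is a complete and cocomplete symmetric monoidal closed category. -/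
open CategoryTheory CategoryTheory.Limits CategoryTheory.MonoidalCategory

namespace Smash16

set_option linter.unusedSectionVars false
set_option linter.unusedSimpArgs false

universe v u

variable {C : Type u} [Category.{v} C] [MonoidalCategory C]
    [SymmetricCategory C] [MonoidalClosed C] [HasLimits C] [HasColimits C]
    {T : C} (hT : IsTerminal T)

/-- The base point of a pointed object. -/
def pt (X : Under T) : T ⟶ X.right := X.hom

/-- The constant map at the base point. -/
def zr (A : C) (W : Under T) : A ⟶ W.right := hT.from A ≫ pt W

@[simp]
lemma pt_right {W V : Under T} (k : W ⟶ V) : pt W ≫ k.right = pt V := Under.w k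

@[simp]
lemma pt_right_assoc {W V : Under T} (k : W ⟶ V) {B : C} (h : V.right ⟶ B) :
    pt W ≫ k.right ≫ h = pt V ≫ h := by
  rw [← Category.assoc, pt_right]

@[simp]
lemma comp_zr {A B : C} (f : A ⟶ B) (W : Under T) : f ≫ zr hT B W = zr hT A W := by
  rw [zr, zr, ← Category.assoc]; congr 1; exact hT.hom_ext _ _

@[simp]
lemma zr_right {A : C} {W V : Under T} (k : W ⟶ V) : zr hT A W ≫ k.right = zr hT A V := by
  simp [zr]

lemma pt_eq_zr (W : Under T) : pt W = zr hT T W := by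
  have : hT.from T = 𝟙 T := hT.hom_ext _ _
  rw [zr, this, Category.id_comp]

/-- The smash product. -/
noncomputable def smash (X Y : Under T) : Under T :=
  Under.mk (Y := pushout
              (coprod.desc (hT.from (X.right ⊗ T)) (hT.from (T ⊗ Y.right)))
              (coprod.desc (X.right ◁ pt Y) (pt X ▷ Y.right))) (pushout.inl _ _)

/-- The projection. -/
noncomputable def pr (X Y : Under T) : X.right ⊗ Y.right ⟶ (smash hT X Y).right :=
  pushout.inr _ _

@[simp]
lemma left_pr (X Y : Under T) : X.right ◁ pt Y ≫ pr hT X Y = zr hT _ _ := by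
  have := coprod.inl ≫= pushout.condition
    (f := coprod.desc (hT.from (X.right ⊗ T)) (hT.from (T ⊗ Y.right)))
    (g := coprod.desc (X.right ◁ pt Y) (pt X ▷ Y.right))
  simp only [coprod.inl_desc_assoc] at this
  exact this.symm

@[simp]
lemma left_pr_assoc (X Y : Under T) {B : C} (h : (smash hT X Y).right ⟶ B) :
    X.right ◁ pt Y ≫ pr hT X Y ≫ h = zr hT _ _ ≫ h := by
  rw [← Category.assoc, left_pr]

@[simp]
lemma right_pr (X Y : Under T) : pt X ▷ Y.right ≫ pr hT X Y = zr hT _ _ := by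
  have := coprod.inr ≫= pushout.condition
    (f := coprod.desc (hT.from (X.right ⊗ T)) (hT.from (T ⊗ Y.right)))
    (g := coprod.desc (X.right ◁ pt Y) (pt X ▷ Y.right))
  simp only [coprod.inr_desc_assoc] at this
  exact this.symm

@[simp]
lemma right_pr_assoc (X Y : Under T) {B : C} (h : (smash hT X Y).right ⟶ B) :
    pt X ▷ Y.right ≫ pr hT X Y ≫ h = zr hT _ _ ≫ h := by
  rw [← Category.assoc, right_pr]

@[simp]
lemma left_zr_pr (X Y : Under T) (A : C) : X.right ◁ zr hT A Y ≫ pr hT X Y = zr hT _ _ := by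
  rw [zr, MonoidalCategory.whiskerLeft_comp, Category.assoc, left_pr, comp_zr]

@[simp]
lemma right_zr_pr (X Y : Under T) (A : C) : zr hT A X ▷ Y.right ≫ pr hT X Y = zr hT _ _ := by
  rw [zr, MonoidalCategory.comp_whiskerRight, Category.assoc, right_pr, comp_zr]

/-- Maps out of the smash product. -/
noncomputable def desc {X Y W : Under T} (f : X.right ⊗ Y.right ⟶ W.right)
    (h₁ : X.right ◁ pt Y ≫ f = zr hT _ _) (h₂ : pt X ▷ Y.right ≫ f = zr hT _ _) :
    smash hT X Y ⟶ W :=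
  Under.homMk (pushout.desc (pt W) f (by
    apply coprod.hom_ext
    · rw [coprod.inl_desc_assoc, coprod.inl_desc_assoc, h₁, zr]
    · rw [coprod.inr_desc_assoc, coprod.inr_desc_assoc, h₂, zr])) (pushout.inl_desc _ _ _)

@[simp]
lemma pr_desc {X Y W : Under T} (f : X.right ⊗ Y.right ⟶ W.right)
    (h₁ : X.right ◁ pt Y ≫ f = zr hT _ _) (h₂ : pt X ▷ Y.right ≫ f = zr hT _ _) :
    pr hT X Y ≫ (desc hT f h₁ h₂).right = f :=
  pushout.inr_desc _ _ _

@[simp]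
lemma pr_desc_assoc {X Y W : Under T} (f : X.right ⊗ Y.right ⟶ W.right)
    (h₁ : X.right ◁ pt Y ≫ f = zr hT _ _) (h₂ : pt X ▷ Y.right ≫ f = zr hT _ _)
    {B : C} (h : W.right ⟶ B) :
    pr hT X Y ≫ (desc hT f h₁ h₂).right ≫ h = f ≫ h := by
  rw [← Category.assoc, pr_desc]

/-- `p` and the base point are jointly epi. -/
def Cov {A : C} {P : Under T} (p : A ⟶ P.right) : Prop :=
  ∀ ⦃W : C⦄ (f g : P.right ⟶ W), p ≫ f = p ≫ g → pt P ≫ f = pt P ≫ g → f = g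

lemma Cov.hom_ext {A : C} {P : Under T} {p : A ⟶ P.right} (hp : Cov p) {W : Under T}
    {f g : P ⟶ W} (h : p ≫ f.right = p ≫ g.right) : f = g := by
  apply Under.UnderMorphism.ext
  apply hp _ _ h
  simp

lemma Cov.left {A : C} {P : Under T} {p : A ⟶ P.right} (hp : Cov p) {B W : C}
    (f g : B ⊗ P.right ⟶ W) (h : B ◁ p ≫ f = B ◁ p ≫ g)
    (h' : B ◁ pt P ≫ f = B ◁ pt P ≫ g) : f = g := by
  apply MonoidalClosed.curry_injective
  apply hp
  · simp only [← MonoidalClosed.curry_natural_left, h]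
  · simp only [← MonoidalClosed.curry_natural_left, h']

lemma Cov.right {A : C} {P : Under T} {p : A ⟶ P.right} (hp : Cov p) {B W : C}
    (f g : P.right ⊗ B ⟶ W) (h : p ▷ B ≫ f = p ▷ B ≫ g)
    (h' : pt P ▷ B ≫ f = pt P ▷ B ≫ g) : f = g := by
  rw [← cancel_epi (β_ B P.right).hom]
  apply hp.left
  · simp [h]
  · simp [h']

lemma cov_pr (X Y : Under T) : Cov (pr hT X Y) := fun _ _ _ h h' => pushout.hom_ext h' h

lemma cov_id (X : Under T) : Cov (𝟙 X.right) := fun _ f g h _ => by simpa using h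

lemma Cov.smash {A B : C} {P Q : Under T} {p : A ⟶ P.right} {q : B ⟶ Q.right}
    (hp : Cov p) (hq : Cov q) : Cov (p ▷ B ≫ P.right ◁ q ≫ pr hT P Q) := by
  intro W f g h h'
  have hz : ∀ A, zr hT A (Smash16.smash hT P Q) ≫ f = zr hT A (Smash16.smash hT P Q) ≫ g := by
    intro A
    simp only [zr, Category.assoc, h']
  refine cov_pr hT _ _ _ _ ?_ h'
  apply hq.left
  · apply hp.right
    · simpa using h
    · rw [← whisker_exchange_assoc, ← whisker_exchange_assoc, right_pr_assoc, right_pr_assoc]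
      simp only [hz]
  · rw [left_pr_assoc, left_pr_assoc, hz]

lemma Cov.smash_right {A : C} {P : Under T} {p : A ⟶ P.right}
    (hp : Cov p) (Q : Under T) : Cov (p ▷ Q.right ≫ pr hT P Q) := by
  have := hp.smash hT (cov_id Q)
  simpa using this

lemma Cov.smash_left {A : C} {P : Under T} {p : A ⟶ P.right}
    (hp : Cov p) (Q : Under T) : Cov (Q.right ◁ p ≫ pr hT Q P) := by
  have := (cov_id Q).smash hT hp
  simpa using this

lemma zr_curry (Z A : C) (W : Under T) :
    zr hT A (Under.mk (MonoidalClosed.curry (zr hT (Z ⊗ T) W))) =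
      MonoidalClosed.curry (zr hT (Z ⊗ A) W) := by
  rw [zr, ← comp_zr hT (Z ◁ hT.from A), MonoidalClosed.curry_natural_left]
  rfl

/-- Maps out of `Z ⊗ (X ∧ Y)`. -/
noncomputable def descL {X Y W : Under T} (Z : C) (f : Z ⊗ (X.right ⊗ Y.right) ⟶ W.right)
    (h₁ : Z ◁ X.right ◁ pt Y ≫ f = zr hT _ _) (h₂ : Z ◁ pt X ▷ Y.right ≫ f = zr hT _ _) :
    Z ⊗ (smash hT X Y).right ⟶ W.right :=
  MonoidalClosed.uncurry (desc hT
    (W := Under.mk (MonoidalClosed.curry (zr hT (Z ⊗ T) W))) (MonoidalClosed.curry f)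
    (by rw [zr_curry, ← h₁, MonoidalClosed.curry_natural_left])
    (by rw [zr_curry, ← h₂, MonoidalClosed.curry_natural_left])).right

section
variable {X Y W : Under T} (Z : C) (f : Z ⊗ (X.right ⊗ Y.right) ⟶ W.right)
    (h₁ : Z ◁ X.right ◁ pt Y ≫ f = zr hT _ _) (h₂ : Z ◁ pt X ▷ Y.right ≫ f = zr hT _ _)

@[simp]
lemma pr_descL : Z ◁ pr hT X Y ≫ descL hT Z f h₁ h₂ = f := by
  rw [descL, ← MonoidalClosed.uncurry_natural_left, pr_desc, MonoidalClosed.uncurry_curry]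

@[simp]
lemma hom_descL : Z ◁ pt (smash hT X Y) ≫ descL hT Z f h₁ h₂ = zr hT _ _ := by
  rw [descL, ← MonoidalClosed.uncurry_natural_left, pt_right]
  exact MonoidalClosed.uncurry_curry _

@[simp]
lemma pr_descL_assoc {B : C} (h : W.right ⟶ B) :
    Z ◁ pr hT X Y ≫ descL hT Z f h₁ h₂ ≫ h = f ≫ h := by
  rw [← Category.assoc, pr_descL]
end

/-- Maps out of `(X ∧ Y) ⊗ Z`. -/
noncomputable def descR {X Y W : Under T} (Z : C) (f : (X.right ⊗ Y.right) ⊗ Z ⟶ W.right)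
    (h₁ : (X.right ◁ pt Y) ▷ Z ≫ f = zr hT _ _) (h₂ : (pt X ▷ Y.right) ▷ Z ≫ f = zr hT _ _) :
    (smash hT X Y).right ⊗ Z ⟶ W.right :=
  (β_ _ _).hom ≫ descL hT Z ((β_ _ _).hom ≫ f)
    (by rw [BraidedCategory.braiding_naturality_right_assoc, h₁, comp_zr])
    (by rw [BraidedCategory.braiding_naturality_right_assoc, h₂, comp_zr])

section
variable {X Y W : Under T} (Z : C) (f : (X.right ⊗ Y.right) ⊗ Z ⟶ W.right)
    (h₁ : (X.right ◁ pt Y) ▷ Z ≫ f = zr hT _ _) (h₂ : (pt X ▷ Y.right) ▷ Z ≫ f = zr hT _ _)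

@[simp]
lemma pr_descR : pr hT X Y ▷ Z ≫ descR hT Z f h₁ h₂ = f := by
  rw [descR, BraidedCategory.braiding_naturality_left_assoc, pr_descL,
    SymmetricCategory.symmetry_assoc]

@[simp]
lemma hom_descR : pt (smash hT X Y) ▷ Z ≫ descR hT Z f h₁ h₂ = zr hT _ _ := by
  rw [descR, BraidedCategory.braiding_naturality_left_assoc, hom_descL, comp_zr]

@[simp]
lemma pr_descR_assoc {B : C} (h : W.right ⟶ B) :
    pr hT X Y ▷ Z ≫ descR hT Z f h₁ h₂ ≫ h = f ≫ h := by
  rw [← Category.assoc, pr_descR]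
end

/-- Functoriality. -/
noncomputable def map {X X' Y Y' : Under T} (f : X ⟶ X') (g : Y ⟶ Y') :
    smash hT X Y ⟶ smash hT X' Y' :=
  desc hT (f.right ▷ Y.right ≫ X'.right ◁ g.right ≫ pr hT X' Y')
    (by rw [whisker_exchange_assoc, ← MonoidalCategory.whiskerLeft_comp_assoc, pt_right,
          left_pr, comp_zr])
    (by rw [← MonoidalCategory.comp_whiskerRight_assoc, pt_right, ← whisker_exchange_assoc,
          right_pr, comp_zr])

@[simp]
lemma pr_map {X X' Y Y' : Under T} (f : X ⟶ X') (g : Y ⟶ Y') :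
    pr hT X Y ≫ (map hT f g).right = f.right ▷ Y.right ≫ X'.right ◁ g.right ≫ pr hT X' Y' :=
  pr_desc _ _ _ _

@[simp]
lemma pr_map_assoc {X X' Y Y' : Under T} (f : X ⟶ X') (g : Y ⟶ Y')
    {B : C} (h : (smash hT X' Y').right ⟶ B) :
    pr hT X Y ≫ (map hT f g).right ≫ h =
      f.right ▷ Y.right ≫ X'.right ◁ g.right ≫ pr hT X' Y' ≫ h := by
  rw [← Category.assoc, pr_map]; simp

/-- The associator. -/
noncomputable def assocHom (X Y Z : Under T) :
    smash hT (smash hT X Y) Z ⟶ smash hT X (smash hT Y Z) :=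
  desc hT (descR hT _ ((α_ _ _ _).hom ≫ X.right ◁ pr hT Y Z ≫ pr hT X (smash hT Y Z))
      (by
        rw [associator_naturality_middle_assoc, ← MonoidalCategory.whiskerLeft_comp_assoc,
          right_pr, left_zr_pr, comp_zr])
      (by
        rw [associator_naturality_left_assoc, ← whisker_exchange_assoc, right_pr, comp_zr,
          comp_zr]))
    (by
      apply (cov_pr hT X Y).right
      · rw [← whisker_exchange_assoc, pr_descR, associator_naturality_right_assoc,
          ← MonoidalCategory.whiskerLeft_comp_assoc, left_pr, left_zr_pr, comp_zr, comp_zr]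
      · rw [← whisker_exchange_assoc, hom_descR, comp_zr, comp_zr])
    (hom_descR _ _ _ _ _)

/-- The inverse of the associator. -/
noncomputable def assocInv (X Y Z : Under T) :
    smash hT X (smash hT Y Z) ⟶ smash hT (smash hT X Y) Z :=
  desc hT (descL hT _ ((α_ _ _ _).inv ≫ pr hT X Y ▷ Z.right ≫ pr hT (smash hT X Y) Z)
      (by
        rw [associator_inv_naturality_right_assoc, whisker_exchange_assoc, left_pr, comp_zr,
          comp_zr])
      (by
        rw [associator_inv_naturality_middle_assoc, ← MonoidalCategory.comp_whiskerRight_assoc,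
          left_pr, right_zr_pr, comp_zr]))
    (hom_descL _ _ _ _ _)
    (by
      apply (cov_pr hT Y Z).left
      · rw [whisker_exchange_assoc, pr_descL, associator_inv_naturality_left_assoc,
          ← MonoidalCategory.comp_whiskerRight_assoc, right_pr, right_zr_pr, comp_zr, comp_zr]
      · rw [whisker_exchange_assoc, hom_descL, comp_zr, comp_zr])

section
variable (X Y Z : Under T)

@[simp]
lemma pr_assocHom : pr hT X Y ▷ Z.right ≫ pr hT (smash hT X Y) Z ≫ (assocHom hT X Y Z).right =
    (α_ _ _ _).hom ≫ X.right ◁ pr hT Y Z ≫ pr hT X (smash hT Y Z) := by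
  rw [assocHom, pr_desc, pr_descR]

@[simp]
lemma pr_assocHom_assoc {B : C} (h : (smash hT X (smash hT Y Z)).right ⟶ B) :
    pr hT X Y ▷ Z.right ≫ pr hT (smash hT X Y) Z ≫ (assocHom hT X Y Z).right ≫ h =
    (α_ _ _ _).hom ≫ X.right ◁ pr hT Y Z ≫ pr hT X (smash hT Y Z) ≫ h := by
  rw [assocHom, pr_desc_assoc, pr_descR_assoc]; simp

@[simp]
lemma pr_assocInv : X.right ◁ pr hT Y Z ≫ pr hT X (smash hT Y Z) ≫ (assocInv hT X Y Z).right =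
    (α_ _ _ _).inv ≫ pr hT X Y ▷ Z.right ≫ pr hT (smash hT X Y) Z := by
  rw [assocInv, pr_desc, pr_descL]

@[simp]
lemma pr_assocInv_assoc {B : C} (h : (smash hT (smash hT X Y) Z).right ⟶ B) :
    X.right ◁ pr hT Y Z ≫ pr hT X (smash hT Y Z) ≫ (assocInv hT X Y Z).right ≫ h =
    (α_ _ _ _).inv ≫ pr hT X Y ▷ Z.right ≫ pr hT (smash hT X Y) Z ≫ h := by
  rw [assocInv, pr_desc_assoc, pr_descL_assoc]; simp

/-- The associator. -/
noncomputable def assoc : smash hT (smash hT X Y) Z ≅ smash hT X (smash hT Y Z) where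
  hom := assocHom hT X Y Z
  inv := assocInv hT X Y Z
  hom_inv_id := by
    apply ((cov_pr hT X Y).smash_right hT Z).hom_ext
    simp
  inv_hom_id := by
    apply ((cov_pr hT Y Z).smash_left hT X).hom_ext
    simp
end

/-- The braiding. -/
noncomputable def braidHom (X Y : Under T) : smash hT X Y ⟶ smash hT Y X :=
  desc hT ((β_ _ _).hom ≫ pr hT Y X)
    (by rw [BraidedCategory.braiding_naturality_right_assoc, right_pr, comp_zr])
    (by rw [BraidedCategory.braiding_naturality_left_assoc, left_pr, comp_zr])

@[simp]
lemma pr_braidHom (X Y : Under T) :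
    pr hT X Y ≫ (braidHom hT X Y).right = (β_ _ _).hom ≫ pr hT Y X := by
  rw [braidHom, pr_desc]

@[simp]
lemma pr_braidHom_assoc (X Y : Under T) {B : C} (h : (smash hT Y X).right ⟶ B) :
    pr hT X Y ≫ (braidHom hT X Y).right ≫ h = (β_ _ _).hom ≫ pr hT Y X ≫ h := by
  rw [braidHom, pr_desc_assoc]; simp

/-- The braiding. -/
noncomputable def braid (X Y : Under T) : smash hT X Y ≅ smash hT Y X where
  hom := braidHom hT X Y
  inv := braidHom hT Y X
  hom_inv_id := by
    apply (cov_pr hT X Y).hom_ext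
    simp
  inv_hom_id := by
    apply (cov_pr hT Y X).hom_ext
    simp

variable (T) in
/-- The unit. -/
noncomputable def unit : Under T := Under.mk (coprod.inr : T ⟶ (𝟙_ C) ⨿ T)

variable (T) in
/-- The inclusion of the unit of `C`. -/
noncomputable def un : 𝟙_ C ⟶ (unit T).right := coprod.inl

lemma cov_un : Cov (un T) := fun _ _ _ hl hr => coprod.hom_ext hl hr

/-- Auxiliary map for the right unitor. -/
noncomputable def rhoAux (X : Under T) : X.right ⊗ (unit T).right ⟶ X.right :=
  MonoidalClosed.uncurry (coprod.desc (MonoidalClosed.curry (ρ_ X.right).hom)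
    (MonoidalClosed.curry (zr hT _ X)))

@[simp]
lemma un_rhoAux (X : Under T) : X.right ◁ un T ≫ rhoAux hT X = (ρ_ _).hom := by
  rw [rhoAux]
  refine (MonoidalClosed.uncurry_natural_left _ _).symm.trans ?_
  refine (congrArg MonoidalClosed.uncurry (coprod.inl_desc _ _)).trans ?_
  rw [MonoidalClosed.uncurry_curry]

@[simp]
lemma pt_rhoAux (X : Under T) : X.right ◁ pt (unit T) ≫ rhoAux hT X = zr hT _ _ := by
  rw [rhoAux]
  refine (MonoidalClosed.uncurry_natural_left _ _).symm.trans ?_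
  refine (congrArg MonoidalClosed.uncurry (coprod.inr_desc _ _)).trans ?_
  rw [MonoidalClosed.uncurry_curry]

/-- The right unitor. -/
noncomputable def rhoHom (X : Under T) : smash hT X (unit T) ⟶ X :=
  desc hT (rhoAux hT X) (pt_rhoAux hT X) (by
    apply cov_un.left
    · rw [whisker_exchange_assoc, un_rhoAux, rightUnitor_naturality, comp_zr, pt_eq_zr hT, comp_zr]
    · rw [whisker_exchange_assoc, pt_rhoAux, comp_zr, comp_zr])

@[simp]
lemma un_rhoHom (X : Under T) :
    X.right ◁ un T ≫ pr hT X (unit T) ≫ (rhoHom hT X).right = (ρ_ _).hom := by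
  rw [rhoHom, pr_desc, un_rhoAux]

@[simp]
lemma un_rhoHom_assoc (X : Under T) {B : C} (h : X.right ⟶ B) :
    X.right ◁ un T ≫ pr hT X (unit T) ≫ (rhoHom hT X).right ≫ h = (ρ_ _).hom ≫ h := by
  rw [← un_rhoHom hT]; simp only [Category.assoc]

/-- The inverse of the right unitor. -/
noncomputable def rhoInv (X : Under T) : X ⟶ smash hT X (unit T) :=
  Under.homMk ((ρ_ _).inv ≫ X.right ◁ un T ≫ pr hT X (unit T)) (by
    change pt X ≫ _ = pt _
    rw [rightUnitor_inv_naturality_assoc, ← whisker_exchange_assoc, right_pr, comp_zr, comp_zr,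
      ← pt_eq_zr])

@[simp]
lemma rhoInv_right (X : Under T) :
    (rhoInv hT X).right = (ρ_ _).inv ≫ X.right ◁ un T ≫ pr hT X (unit T) := rfl

/-- The right unitor. -/
noncomputable def rho (X : Under T) : smash hT X (unit T) ≅ X where
  hom := rhoHom hT X
  inv := rhoInv hT X
  hom_inv_id := by
    apply (cov_un.smash_left hT X).hom_ext
    simp
  inv_hom_id := by
    apply (cov_id X).hom_ext
    simp

/-- The left unitor. -/
noncomputable def lam (X : Under T) : smash hT (unit T) X ≅ X := braid hT _ _ ≪≫ rho hT X

@[simp]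
lemma un_lam (X : Under T) :
    un T ▷ X.right ≫ pr hT (unit T) X ≫ (lam hT X).hom.right = (λ_ _).hom := by
  simp [lam, braid, rho]

@[simp]
lemma un_lam_assoc (X : Under T) {B : C} (h : X.right ⟶ B) :
    un T ▷ X.right ≫ pr hT (unit T) X ≫ (lam hT X).hom.right ≫ h = (λ_ _).hom ≫ h := by
  rw [← un_lam hT]; simp only [Category.assoc]


section
variable (T)

/-- The data of the smash monoidal structure. -/
@[reducible]
noncomputable def monStruct : MonoidalCategoryStruct (Under T) where
  tensorObj := smash hT
  whiskerLeft X _ _ f := map hT (𝟙 X) f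
  whiskerRight f X := map hT f (𝟙 X)
  tensorHom f g := map hT f g
  tensorUnit := unit T
  associator := assoc hT
  leftUnitor := lam hT
  rightUnitor := rho hT

end

lemma map_id (X Y : Under T) : map hT (𝟙 X) (𝟙 Y) = 𝟙 (smash hT X Y) := by
  apply (cov_pr hT X Y).hom_ext
  simp

lemma map_comp {X Y Z X' Y' Z' : Under T} (f : X ⟶ Y) (f' : X' ⟶ Y') (g : Y ⟶ Z) (g' : Y' ⟶ Z') :
    map hT f f' ≫ map hT g g' = map hT (f ≫ g) (f' ≫ g') := by
  apply (cov_pr hT X X').hom_ext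
  simp [whisker_exchange_assoc]

lemma assoc_nat {X Y Z X' Y' Z' : Under T} (f : X ⟶ X') (g : Y ⟶ Y') (h : Z ⟶ Z') :
    map hT (map hT f g) h ≫ assocHom hT X' Y' Z' =
      assocHom hT X Y Z ≫ map hT f (map hT g h) := by
  apply ((cov_pr hT X Y).smash_right hT Z).hom_ext
  simp only [Under.comp_right, Category.assoc, pr_map_assoc, pr_assocHom_assoc, pr_map]
  rw [← MonoidalCategory.comp_whiskerRight_assoc, pr_map]
  simp only [MonoidalCategory.comp_whiskerRight, Category.assoc]
  rw [← whisker_exchange_assoc, pr_assocHom, whisker_exchange_assoc,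
    ← MonoidalCategory.whiskerLeft_comp_assoc X'.right, pr_map]
  simp

lemma lam_nat {X Y : Under T} (f : X ⟶ Y) :
    map hT (𝟙 (unit T)) f ≫ (lam hT Y).hom = (lam hT X).hom ≫ f := by
  apply (cov_un.smash_right hT X).hom_ext
  simp [← whisker_exchange_assoc]

lemma rho_nat {X Y : Under T} (f : X ⟶ Y) :
    map hT f (𝟙 (unit T)) ≫ rhoHom hT Y = rhoHom hT X ≫ f := by
  apply (cov_un.smash_left hT X).hom_ext
  simp [whisker_exchange_assoc]

lemma pentagon_aux (W X Y Z : Under T) :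
    map hT (assocHom hT W X Y) (𝟙 Z) ≫ assocHom hT W (smash hT X Y) Z ≫
      map hT (𝟙 W) (assocHom hT X Y Z) =
    assocHom hT (smash hT W X) Y Z ≫ assocHom hT W X (smash hT Y Z) := by
  apply (((cov_pr hT W X).smash_right hT Y).smash_right hT Z).hom_ext
  simp only [Under.comp_right, Category.assoc, pr_map_assoc, pr_assocHom_assoc, pr_map,
    MonoidalCategory.comp_whiskerRight, Under.id_right, MonoidalCategory.whiskerLeft_id,
    MonoidalCategory.id_whiskerRight, Category.id_comp]
  rw [← MonoidalCategory.comp_whiskerRight_assoc (pr hT (smash hT W X) Y),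
    ← MonoidalCategory.comp_whiskerRight_assoc (pr hT W X ▷ Y.right), pr_assocHom]
  simp only [MonoidalCategory.comp_whiskerRight, Category.assoc, pr_assocHom_assoc]
  rw [associator_naturality_middle_assoc, pr_map, Under.id_right,
    MonoidalCategory.id_whiskerRight, Category.id_comp,
    ← MonoidalCategory.whiskerLeft_comp_assoc W.right (pr hT (smash hT X Y) Z),
    ← MonoidalCategory.whiskerLeft_comp_assoc W.right (pr hT X Y ▷ Z.right), pr_assocHom,
    associator_naturality_left_assoc, ← whisker_exchange_assoc, pr_assocHom]
  simp

lemma triangle_aux (X Y : Under T) :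
    assocHom hT X (unit T) Y ≫ map hT (𝟙 X) (lam hT Y).hom = map hT (rhoHom hT X) (𝟙 Y) := by
  apply ((cov_un.smash_left hT X).smash_right hT Y).hom_ext
  simp only [Under.comp_right, Category.assoc, pr_map_assoc, pr_assocHom_assoc, pr_map,
    MonoidalCategory.comp_whiskerRight, Under.id_right, MonoidalCategory.whiskerLeft_id,
    MonoidalCategory.id_whiskerRight, Category.id_comp]
  rw [← MonoidalCategory.comp_whiskerRight_assoc (pr hT X (unit T)),
    ← MonoidalCategory.comp_whiskerRight_assoc (X.right ◁ un T), un_rhoHom,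
    associator_naturality_middle_assoc,
    ← MonoidalCategory.whiskerLeft_comp_assoc X.right (pr hT (unit T) Y),
    ← MonoidalCategory.whiskerLeft_comp_assoc X.right (un T ▷ Y.right), un_lam,
    MonoidalCategory.triangle_assoc]

lemma braid_nat {X Y X' Y' : Under T} (f : X ⟶ X') (g : Y ⟶ Y') :
    map hT f g ≫ braidHom hT X' Y' = braidHom hT X Y ≫ map hT g f := by
  apply (cov_pr hT X Y).hom_ext
  simp [whisker_exchange_assoc]

lemma hexagon₁ (X Y Z : Under T) :
    assocHom hT X Y Z ≫ braidHom hT X (smash hT Y Z) ≫ assocHom hT Y Z X =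
      map hT (braidHom hT X Y) (𝟙 Z) ≫ assocHom hT Y X Z ≫ map hT (𝟙 Y) (braidHom hT X Z) := by
  apply ((cov_pr hT X Y).smash_right hT Z).hom_ext
  simp only [Under.comp_right, Category.assoc, pr_map_assoc, pr_assocHom_assoc, pr_map,
    Under.id_right, MonoidalCategory.whiskerLeft_id, pr_braidHom_assoc,
    MonoidalCategory.id_whiskerRight, Category.id_comp,
    BraidedCategory.braiding_naturality_right_assoc, pr_assocHom]
  rw [← MonoidalCategory.comp_whiskerRight_assoc, pr_braidHom]
  simp only [MonoidalCategory.comp_whiskerRight, Category.assoc, pr_assocHom_assoc, pr_map,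
    Under.id_right, MonoidalCategory.id_whiskerRight, Category.id_comp]
  rw [← MonoidalCategory.whiskerLeft_comp_assoc Y.right (pr hT X Z), pr_braidHom,
    BraidedCategory.hexagon_forward_assoc]
  simp only [MonoidalCategory.whiskerLeft_comp, Category.assoc]

lemma hexagon₂ (X Y Z : Under T) :
    assocInv hT X Y Z ≫ braidHom hT (smash hT X Y) Z ≫ assocInv hT Z X Y =
      map hT (𝟙 X) (braidHom hT Y Z) ≫ assocInv hT X Z Y ≫ map hT (braidHom hT X Z) (𝟙 Y) := by
  apply ((cov_pr hT Y Z).smash_left hT X).hom_ext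
  simp only [Under.comp_right, Category.assoc, pr_map_assoc, pr_assocInv_assoc, pr_map,
    Under.id_right, MonoidalCategory.whiskerLeft_id, pr_braidHom_assoc,
    MonoidalCategory.id_whiskerRight, Category.id_comp,
    BraidedCategory.braiding_naturality_left_assoc, pr_assocInv]
  rw [← MonoidalCategory.whiskerLeft_comp_assoc, pr_braidHom]
  simp only [MonoidalCategory.whiskerLeft_comp, Category.assoc, pr_assocInv_assoc, pr_map,
    Under.id_right, MonoidalCategory.whiskerLeft_id, Category.id_comp]
  rw [← MonoidalCategory.comp_whiskerRight_assoc (pr hT X Z), pr_braidHom,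
    BraidedCategory.hexagon_reverse_assoc]
  simp only [MonoidalCategory.comp_whiskerRight, Category.assoc]

/-- The pointed hom. -/
noncomputable def phom (X Y : Under T) : Under T :=
  Under.mk (Y := pullback ((MonoidalClosed.pre (pt X)).app Y.right)
      (MonoidalClosed.curry (hT.from (T ⊗ T) ≫ pt Y)))
    (pullback.lift (MonoidalClosed.curry (zr hT (X.right ⊗ T) Y)) (𝟙 T) (by
      rw [MonoidalClosed.curry_pre_app, comp_zr, Category.id_comp]; rfl))

/-- The map from the pointed hom to the hom. -/
noncomputable def phomFst (X Y : Under T) : (phom hT X Y).right ⟶ (ihom X.right).obj Y.right :=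
  pullback.fst _ _

lemma phom_cond (X Y : Under T) : pt X ▷ _ ≫ MonoidalClosed.uncurry (phomFst hT X Y) =
    zr hT _ _ := by
  have h : phomFst hT X Y ≫ (MonoidalClosed.pre (pt X)).app Y.right =
      hT.from _ ≫ MonoidalClosed.curry (zr hT (T ⊗ T) Y) :=
    pullback.condition.trans (congrArg (· ≫ _) (hT.hom_ext _ _))
  rw [← MonoidalClosed.uncurry_pre_app, h, MonoidalClosed.uncurry_natural_left,
    MonoidalClosed.uncurry_curry, comp_zr]

lemma pt_phom (X Y : Under T) : X.right ◁ pt (phom hT X Y) ≫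
    MonoidalClosed.uncurry (phomFst hT X Y) = zr hT _ _ := by
  have h : pt (phom hT X Y) ≫ phomFst hT X Y = MonoidalClosed.curry (zr hT (X.right ⊗ T) Y) :=
    pullback.lift_fst _ _ _
  rw [← MonoidalClosed.uncurry_natural_left, h, MonoidalClosed.uncurry_curry]

lemma phom_ext {X Y : Under T} {A : C} (f g : A ⟶ (phom hT X Y).right)
    (h : f ≫ phomFst hT X Y = g ≫ phomFst hT X Y) : f = g :=
  pullback.hom_ext h (hT.hom_ext _ _)

/-- Currying. -/
noncomputable def toPhom {X Y Z : Under T} (f : smash hT X Y ⟶ Z) : Y ⟶ phom hT X Z :=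
  Under.homMk (pullback.lift (MonoidalClosed.curry (pr hT X Y ≫ f.right)) (hT.from _) (by
      have h : hT.from Y.right ≫ MonoidalClosed.curry (zr hT (T ⊗ T) Z) =
          MonoidalClosed.curry (zr hT _ Z) := by
        rw [← MonoidalClosed.curry_natural_left, comp_zr]
      rw [MonoidalClosed.curry_pre_app, right_pr_assoc, zr_right]
      exact h.symm)) (by
      change pt Y ≫ (_ : Y.right ⟶ (phom hT X Z).right) = pt (phom hT X Z)
      apply phom_ext
      have h : pt (phom hT X Z) ≫ phomFst hT X Z = MonoidalClosed.curry (zr hT (X.right ⊗ T) Z) :=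
        pullback.lift_fst _ _ _
      rw [h]
      refine (Category.assoc _ _ _).trans ?_
      refine (congrArg (pt Y ≫ ·) (pullback.lift_fst _ _ _)).trans ?_
      rw [← MonoidalClosed.curry_natural_left, left_pr_assoc, zr_right])

lemma toPhom_fst {X Y Z : Under T} (f : smash hT X Y ⟶ Z) :
    (toPhom hT f).right ≫ phomFst hT X Z = MonoidalClosed.curry (pr hT X Y ≫ f.right) :=
  pullback.lift_fst _ _ _

/-- Uncurrying. -/
noncomputable def ofPhom {X Y Z : Under T} (g : Y ⟶ phom hT X Z) : smash hT X Y ⟶ Z :=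
  desc hT (MonoidalClosed.uncurry (g.right ≫ phomFst hT X Z)) (by
      rw [MonoidalClosed.uncurry_natural_left, ← MonoidalCategory.whiskerLeft_comp_assoc, pt_right,
        pt_phom])
    (by
      rw [MonoidalClosed.uncurry_natural_left, ← whisker_exchange_assoc, phom_cond, comp_zr])

/-- The hom equivalence. -/
noncomputable def phomEquiv (X Y Z : Under T) : (smash hT X Y ⟶ Z) ≃ (Y ⟶ phom hT X Z) where
  toFun := toPhom hT
  invFun := ofPhom hT
  left_inv f := by
    apply (cov_pr hT X Y).hom_ext
    rw [ofPhom, pr_desc, toPhom_fst, MonoidalClosed.uncurry_curry]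
  right_inv g := by
    apply Under.UnderMorphism.ext
    apply phom_ext
    rw [toPhom_fst, ofPhom, pr_desc, MonoidalClosed.curry_uncurry]

lemma toPhom_nat {X Y Y' Z : Under T} (f : Y' ⟶ Y) (g : smash hT X Y ⟶ Z) :
    toPhom hT (map hT (𝟙 X) f ≫ g) = f ≫ toPhom hT g := by
  apply Under.UnderMorphism.ext
  apply phom_ext
  rw [toPhom_fst, Under.comp_right, Under.comp_right, Category.assoc, toPhom_fst, pr_map_assoc,
    ← MonoidalClosed.curry_natural_left]
  simp

/-- The smash monoidal structure. -/
@[reducible]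
noncomputable def mon : MonoidalCategory (Under T) :=
  { monStruct T hT with
    tensorHom_def := fun f g => by
      refine Eq.symm ((map_comp hT _ _ _ _).trans ?_)
      rw [Category.comp_id, Category.id_comp]; rfl
    id_tensorHom_id := map_id hT
    tensorHom_comp_tensorHom := map_comp hT
    whiskerLeft_id := map_id hT
    id_whiskerRight := map_id hT
    associator_naturality := assoc_nat hT
    leftUnitor_naturality := lam_nat hT
    rightUnitor_naturality := rho_nat hT
    pentagon := pentagon_aux hT
    triangle := triangle_aux hT }

/-- The symmetry of the smash product. -/
@[reducible]
noncomputable def symm : @SymmetricCategory (Under T) _ (mon hT) :=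
  letI := mon hT
  { braiding := braid hT
    braiding_naturality_right := fun X _ _ f => braid_nat hT (𝟙 X) f
    braiding_naturality_left := fun f X => braid_nat hT f (𝟙 X)
    hexagon_forward := hexagon₁ hT
    hexagon_reverse := hexagon₂ hT
    symmetry := fun X Y => (braid hT X Y).hom_inv_id }

/-- The closed structure. -/
@[reducible]
noncomputable def closed : @MonoidalClosed (Under T) _ (mon hT) :=
  letI := mon hT
  { closed := fun X =>
      { rightAdj := Adjunction.rightAdjointOfEquiv (F := tensorLeft X) (G_obj := phom hT X)
          (phomEquiv hT X) (fun _ _ _ f g => toPhom_nat hT f g)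
        adj := Adjunction.adjunctionOfEquivRight (F := tensorLeft X) (G_obj := phom hT X)
          (phomEquiv hT X) (fun _ _ _ f g => toPhom_nat hT f g) } }

end Smash16

/-- STATEMENT 16: if `(C, ⊗, 𝟙, Hom)` is a complete and cocomplete symmetric
monoidal closed category with terminal object `T`, then the category of pointed
objects `T/C`, equipped with the smash product (the pushout of
`T ← (X ⊗ T) ⊔ (T ⊗ Y) → X ⊗ Y`), smash unit `E = 𝟙 ⊔ T`, and pointed hom
(the pullback of `Hom(X,Y) → Hom(T,Y) ← T`), is a complete and cocomplete
symmetric monoidal closed category. -/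
theorem statement16 {C : Type*} [Category C] [MonoidalCategory C]
    [SymmetricCategory C] [MonoidalClosed C] [HasLimits C] [HasColimits C]
    (T : C) (hT : IsTerminal T) :
    HasLimits (Under T) ∧ HasColimits (Under T) ∧
    ∃ M : MonoidalCategory (Under T),
      (∃ hsmash : ∀ X Y : Under T,
          (M.tensorObj X Y).right =
            pushout
              (coprod.desc (hT.from (X.right ⊗ T)) (hT.from (T ⊗ Y.right)))
              (coprod.desc (X.right ◁ Y.hom) (X.hom ▷ Y.right)),
        ∀ X Y : Under T, (M.tensorObj X Y).hom ≫ eqToHom (hsmash X Y) =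
          pushout.inl _ _) ∧
      (∃ hunit : (M.tensorUnit).right = ((𝟙_ C) ⨿ T),
        (M.tensorUnit).hom ≫ eqToHom hunit = coprod.inr) ∧
      Nonempty (@SymmetricCategory (Under T) _ M) ∧
      ∃ Cl : @MonoidalClosed (Under T) _ M,
        ∀ X Y : Under T,
          (((Cl.closed X).rightAdj).obj Y).right =
            pullback
              ((MonoidalClosed.pre X.hom).app Y.right)
              (MonoidalClosed.curry (hT.from (T ⊗ T) ≫ Y.hom)) := by
  refine ⟨inferInstance, inferInstance, Smash16.mon hT, ⟨fun _ _ => rfl, fun X Y => ?_⟩,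
    ⟨rfl, ?_⟩, ⟨Smash16.symm hT⟩, Smash16.closed hT, fun X Y => rfl⟩
  · exact Category.comp_id _
  · exact Category.comp_id _
end
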